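/- Let Γ be an ABox in NNF of size n. Then the cardinality of cls_Z(Γ) is O(n^4), and there exists a polynomial f such that the cardinality of cls(Γ) is O(2^{f(n)}). -/

import Mathlib

set_option maxHeartbeats 1000000

/-! ## Syntax of HPDL (base language) -/

/-- Nominals. -/
abbrev Nom := ℕ
/-- Propositions. -/
abbrev Prp := ℕ
/-- Atomic programs. -/
abbrev APg := ℕ

mutual
/-- Formulas of the base language of HPDL. -/
inductive Fm : Type where
  | top | bot
  | prp (p : Prp) | nom (a : Nom)
  | neg (φ : Fm) | land (φ ψ : Fm) | lor (φ ψ : Fm) | imp (φ ψ : Fm)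
  | dia (α : Pg) (φ : Fm) | box (α : Pg) (φ : Fm)
/-- Programs of HPDL. -/
inductive Pg : Type where
  | atom (σ : APg) | seq (α β : Pg) | choice (α β : Pg) | star (α : Pg) | test (φ : Fm)
end

noncomputable instance : DecidableEq Fm := Classical.decEq _
noncomputable instance : DecidableEq Pg := Classical.decEq _

/-! ## Kripke semantics -/

/-- A Kripke model for HPDL. -/
structure Kripke where
  W : Type
  nomI : Nom → W
  prpI : Prp → Set W
  progI : APg → Set (W × W)

mutual
/-- Interpretation of formulas. -/
def Fm.sem (M : Kripke) : Fm → Set M.W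
  | .top => Set.univ
  | .bot => ∅
  | .prp p => M.prpI p
  | .nom a => {M.nomI a}
  | .neg φ => (Fm.sem M φ)ᶜ
  | .land φ ψ => Fm.sem M φ ∩ Fm.sem M ψ
  | .lor φ ψ => Fm.sem M φ ∪ Fm.sem M ψ
  | .imp φ ψ => (Fm.sem M φ)ᶜ ∪ Fm.sem M ψ
  | .dia α φ => {x | ∃ y, (x, y) ∈ Pg.sem M α ∧ y ∈ Fm.sem M φ}
  | .box α φ => {x | ∀ y, (x, y) ∈ Pg.sem M α → y ∈ Fm.sem M φ}
/-- Interpretation of programs. -/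
def Pg.sem (M : Kripke) : Pg → Set (M.W × M.W)
  | .atom σ => M.progI σ
  | .seq α β => {p | ∃ z, (p.1, z) ∈ Pg.sem M α ∧ (z, p.2) ∈ Pg.sem M β}
  | .choice α β => Pg.sem M α ∪ Pg.sem M β
  | .star α => {p | Relation.ReflTransGen (fun x y => (x, y) ∈ Pg.sem M α) p.1 p.2}
  | .test φ => {p | p.1 = p.2 ∧ p.1 ∈ Fm.sem M φ}
end

/-! ## Assertions and ABoxes -/

/-- An assertion is `a:φ` or `σ(a,b)`. -/
inductive Assertion : Type where
  | mem (a : Nom) (φ : Fm)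
  | rel (σ : APg) (a b : Nom)

noncomputable instance : DecidableEq Assertion := Classical.decEq _

/-- `M ⊨ ξ` for an assertion `ξ`. -/
def Kripke.satisfies (M : Kripke) : Assertion → Prop
  | .mem a φ => M.nomI a ∈ Fm.sem M φ
  | .rel σ a b => (M.nomI a, M.nomI b) ∈ M.progI σ

/-- An ABox (finite set of assertions) is satisfiable if some Kripke model
satisfies all its assertions. -/
def ABoxSat (Γ : Finset Assertion) : Prop :=
  ∃ M : Kripke, ∀ ξ ∈ Γ, M.satisfies ξ

/-! ## Negation normal form and length -/

mutual
/-- A formula is in NNF iff it does not use `→` and uses `¬` only immediately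
before propositions or nominals. -/
def Fm.isNNF : Fm → Prop
  | .top => True
  | .bot => True
  | .prp _ => True
  | .nom _ => True
  | .neg (.prp _) => True
  | .neg (.nom _) => True
  | .neg _ => False
  | .land φ ψ => φ.isNNF ∧ ψ.isNNF
  | .lor φ ψ => φ.isNNF ∧ ψ.isNNF
  | .imp _ _ => False
  | .dia α φ => α.isNNF ∧ φ.isNNF
  | .box α φ => α.isNNF ∧ φ.isNNF
def Pg.isNNF : Pg → Prop
  | .atom _ => True
  | .seq α β => α.isNNF ∧ β.isNNF
  | .choice α β => α.isNNF ∧ β.isNNF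
  | .star α => α.isNNF
  | .test φ => φ.isNNF
end

mutual
/-- The length (number of symbol occurrences) of a formula. -/
def Fm.len : Fm → ℕ
  | .top => 1 | .bot => 1 | .prp _ => 1 | .nom _ => 1
  | .neg φ => 1 + φ.len
  | .land φ ψ => 1 + φ.len + ψ.len
  | .lor φ ψ => 1 + φ.len + ψ.len
  | .imp φ ψ => 1 + φ.len + ψ.len
  | .dia α φ => 1 + α.len + φ.len
  | .box α φ => 1 + α.len + φ.len
/-- The length (number of symbol occurrences) of a program. -/
def Pg.len : Pg → ℕ
  | .atom _ => 1
  | .seq α β => 1 + α.len + β.len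
  | .choice α β => 1 + α.len + β.len
  | .star α => 1 + α.len
  | .test φ => 1 + φ.len
end

/-- The length of an assertion. -/
def Assertion.len : Assertion → ℕ
  | .mem _ φ => 2 + φ.len
  | .rel _ _ _ => 3

/-- An assertion in NNF. -/
def Assertion.isNNF : Assertion → Prop
  | .mem _ φ => φ.isNNF
  | .rel _ _ _ => True

/-- An ABox in NNF. -/
def ABoxInNNF (Γ : Finset Assertion) : Prop := ∀ ξ ∈ Γ, ξ.isNNF

/-- The size of an ABox: the sum of the lengths of its assertions. -/
def aboxSize (Γ : Finset Assertion) : ℕ := ∑ ξ ∈ Γ, ξ.len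

/-- The NNF of the negation of a formula (assuming the input is in NNF). -/
def Fm.nnfNeg : Fm → Fm
  | .top => .bot
  | .bot => .top
  | .prp p => .neg (.prp p)
  | .nom a => .neg (.nom a)
  | .neg φ => φ
  | .land φ ψ => .lor φ.nnfNeg ψ.nnfNeg
  | .lor φ ψ => .land φ.nnfNeg ψ.nnfNeg
  | .imp φ ψ => .land φ ψ.nnfNeg
  | .dia α φ => .box α φ.nnfNeg
  | .box α φ => .dia α φ.nnfNeg
/-! ## Automata over alphabets of atomic programs and tests -/

/-- A letter of the alphabet `Σ(α)` of a program: an atomic program or a test. -/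
inductive Lab : Type where
  | atom (σ : APg) | test (φ : Fm)

/-- A letter viewed as a program. -/
def Lab.toPg : Lab → Pg
  | .atom σ => .atom σ
  | .test φ => .test φ

/-- A finite automaton over an alphabet of atomic programs and tests.
(`states`, `init`, `accept` are finite sets of natural numbers.) -/
structure Aut : Type where
  states : Finset ℕ
  init : Finset ℕ
  trans : ℕ → Lab → ℕ → Prop
  accept : Finset ℕ

/-- `AutAccepts A q w` : the automaton `A`, started at state `q`, accepts the
word `w` (i.e. `(A,q)` accepts `w`). -/
inductive AutAccepts (A : Aut) : ℕ → List Lab → Prop where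
  | nil {q : ℕ} : q ∈ A.accept → AutAccepts A q []
  | cons {q : ℕ} {ω : Lab} {q' : ℕ} {w : List Lab} :
      A.trans q ω q' → AutAccepts A q' w → AutAccepts A q (ω :: w)

/-- The language accepted by the automaton `A` (from its initial states). -/
def AutLang (A : Aut) (w : List Lab) : Prop := ∃ q ∈ A.init, AutAccepts A q w

/-- The alphabet `Σ(α)` of a program. -/
def Pg.alphabet : Pg → Set Lab
  | .atom σ => {.atom σ}
  | .test φ => {.test φ}
  | .seq α β => α.alphabet ∪ β.alphabet
  | .choice α β => α.alphabet ∪ β.alphabet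
  | .star α => α.alphabet

/-- The regular language `L(α)` generated by a program `α` viewed as a regular
expression over `Σ(α)`. -/
def Pg.lang : Pg → Set (List Lab)
  | .atom σ => {[.atom σ]}
  | .test φ => {[.test φ]}
  | .seq α β => {w | ∃ u ∈ α.lang, ∃ v ∈ β.lang, w = u ++ v}
  | .choice α β => α.lang ∪ β.lang
  | .star α => {w | ∃ l : List (List Lab), (∀ u ∈ l, u ∈ α.lang) ∧ w = l.flatten}

/-- The interpretation of a letter (as a program). -/
def Lab.sem (M : Kripke) : Lab → Set (M.W × M.W)
  | .atom σ => M.progI σ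
  | .test φ => {p | p.1 = p.2 ∧ p.1 ∈ Fm.sem M φ}

/-- The interpretation of a word `ω₁…ω_k`, treated as the program `ω₁;…;ω_k`
(the empty word denotes the identity program). -/
def wordSem (M : Kripke) : List Lab → Set (M.W × M.W)
  | [] => {p | p.1 = p.2}
  | ω :: w => {p | ∃ z, (p.1, z) ∈ Lab.sem M ω ∧ (z, p.2) ∈ wordSem M w}

/-! ## The extended language of HPDL (with automaton-modal operators) -/

/-- Formulas of the extended language of HPDL, admitting the automaton-modal
operators `[A,q]` and `⟨A,q⟩`. -/
inductive EFm : Type where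
  | top | bot
  | prp (p : Prp) | nom (a : Nom)
  | neg (φ : EFm) | land (φ ψ : EFm) | lor (φ ψ : EFm) | imp (φ ψ : EFm)
  | dia (α : Pg) (φ : EFm) | box (α : Pg) (φ : EFm)
  | diaA (A : Aut) (q : ℕ) (φ : EFm) | boxA (A : Aut) (q : ℕ) (φ : EFm)

/-- Interpretation of extended formulas, where `(⟨A,q⟩φ)^M` and `([A,q]φ)^M`
are interpreted via the program `(A,q)` with `A^M = ⋃ {γ^M : γ ∈ L(A)}`. -/
def EFm.sem (M : Kripke) : EFm → Set M.W
  | .top => Set.univ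
  | .bot => ∅
  | .prp p => M.prpI p
  | .nom a => {M.nomI a}
  | .neg φ => (EFm.sem M φ)ᶜ
  | .land φ ψ => EFm.sem M φ ∩ EFm.sem M ψ
  | .lor φ ψ => EFm.sem M φ ∪ EFm.sem M ψ
  | .imp φ ψ => (EFm.sem M φ)ᶜ ∪ EFm.sem M ψ
  | .dia α φ => {x | ∃ y, (x, y) ∈ Pg.sem M α ∧ y ∈ EFm.sem M φ}
  | .box α φ => {x | ∀ y, (x, y) ∈ Pg.sem M α → y ∈ EFm.sem M φ}
  | .diaA A q φ => {x | ∃ w, AutAccepts A q w ∧ ∃ y, (x, y) ∈ wordSem M w ∧ y ∈ EFm.sem M φ}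
  | .boxA A q φ => {x | ∀ w, AutAccepts A q w → ∀ y, (x, y) ∈ wordSem M w → y ∈ EFm.sem M φ}

/-- Embedding of base formulas into the extended language. -/
def Fm.toE : Fm → EFm
  | .top => .top | .bot => .bot | .prp p => .prp p | .nom a => .nom a
  | .neg φ => .neg φ.toE
  | .land φ ψ => .land φ.toE ψ.toE
  | .lor φ ψ => .lor φ.toE ψ.toE
  | .imp φ ψ => .imp φ.toE ψ.toE
  | .dia α φ => .dia α φ.toE
  | .box α φ => .box α φ.toE

/-- The NNF of the negation of an extended formula (for formulas in NNF). -/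
def EFm.nnfNeg : EFm → EFm
  | .top => .bot
  | .bot => .top
  | .prp p => .neg (.prp p)
  | .nom a => .neg (.nom a)
  | .neg φ => φ
  | .land φ ψ => .lor φ.nnfNeg ψ.nnfNeg
  | .lor φ ψ => .land φ.nnfNeg ψ.nnfNeg
  | .imp φ ψ => .land φ ψ.nnfNeg
  | .dia α φ => .box α φ.nnfNeg
  | .box α φ => .dia α φ.nnfNeg
  | .diaA A q φ => .boxA A q φ.nnfNeg
  | .boxA A q φ => .diaA A q φ.nnfNeg
/-! ## Items: formulas and assertions of the extended language -/

/-- An item is a formula, an assertion `a:φ`, or an assertion `σ(a,b)`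
(in the extended language). -/
inductive Item : Type where
  | fm (φ : EFm)
  | mem (a : Nom) (φ : EFm)
  | rel (σ : APg) (a b : Nom)

/-- A base assertion as an item. -/
def Assertion.toItem : Assertion → Item
  | .mem a φ => .mem a φ.toE
  | .rel σ a b => .rel σ a b

def Item.isFormula : Item → Prop
  | .fm _ => True
  | _ => False

def Item.isAssertion : Item → Prop
  | .fm _ => False
  | _ => True

/-- Satisfaction of an item in a Kripke model (a formula is satisfied iff its
interpretation is nonempty). -/
def Kripke.satItem (M : Kripke) : Item → Prop
  | .fm φ => (EFm.sem M φ).Nonempty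
  | .mem a φ => M.nomI a ∈ EFm.sem M φ
  | .rel σ a b => (M.nomI a, M.nomI b) ∈ M.progI σ

/-! ## Subformulas, occurrences of nominals, replacement of nominals -/

mutual
/-- `Subf φ ψ` : `φ` is a subformula of `ψ`. -/
inductive Subf : Fm → Fm → Prop where
  | refl (φ : Fm) : Subf φ φ
  | neg {φ ψ : Fm} : Subf φ ψ → Subf φ (.neg ψ)
  | andl {φ ψ₁ ψ₂ : Fm} : Subf φ ψ₁ → Subf φ (.land ψ₁ ψ₂)
  | andr {φ ψ₂ ψ₁ : Fm} : Subf φ ψ₂ → Subf φ (.land ψ₁ ψ₂)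
  | orl {φ ψ₁ ψ₂ : Fm} : Subf φ ψ₁ → Subf φ (.lor ψ₁ ψ₂)
  | orr {φ ψ₂ ψ₁ : Fm} : Subf φ ψ₂ → Subf φ (.lor ψ₁ ψ₂)
  | impl {φ ψ₁ ψ₂ : Fm} : Subf φ ψ₁ → Subf φ (.imp ψ₁ ψ₂)
  | impr {φ ψ₂ ψ₁ : Fm} : Subf φ ψ₂ → Subf φ (.imp ψ₁ ψ₂)
  | diaf {φ ψ : Fm} {α : Pg} : Subf φ ψ → Subf φ (.dia α ψ)
  | diap {φ : Fm} {α : Pg} {ψ : Fm} : SubfP φ α → Subf φ (.dia α ψ)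
  | boxf {φ ψ : Fm} {α : Pg} : Subf φ ψ → Subf φ (.box α ψ)
  | boxp {φ : Fm} {α : Pg} {ψ : Fm} : SubfP φ α → Subf φ (.box α ψ)
/-- `SubfP φ α` : `φ` is a subformula of the program `α` (inside a test). -/
inductive SubfP : Fm → Pg → Prop where
  | test {φ ψ : Fm} : Subf φ ψ → SubfP φ (.test ψ)
  | seql {φ : Fm} {α β : Pg} : SubfP φ α → SubfP φ (.seq α β)
  | seqr {φ : Fm} {β α : Pg} : SubfP φ β → SubfP φ (.seq α β)
  | chl {φ : Fm} {α β : Pg} : SubfP φ α → SubfP φ (.choice α β)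
  | chr {φ : Fm} {β α : Pg} : SubfP φ β → SubfP φ (.choice α β)
  | star {φ : Fm} {α : Pg} : SubfP φ α → SubfP φ (.star α)
end

/-- `bsf Γ` : all subformulas of `Γ` together with their negations in NNF. -/
def bsf (Γ : Finset Assertion) : Set Fm :=
  {φ | ∃ ξ ∈ Γ, ∃ a ψ, ξ = Assertion.mem a ψ ∧ Subf φ ψ} ∪
  {φ | ∃ ξ ∈ Γ, ∃ a ψ χ, ξ = Assertion.mem a ψ ∧ Subf χ ψ ∧ φ = χ.nnfNeg}

/-- The nominal `a` occurs in the ABox `Γ`. -/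
def NomOccurs (a : Nom) (Γ : Finset Assertion) : Prop :=
  ∃ ξ ∈ Γ, (match ξ with
    | .mem b φ => a = b ∨ Subf (.nom a) φ
    | .rel _ b c => a = b ∨ a = c)

mutual
/-- Replace every occurrence of the nominal `b` by `a` in a base formula. -/
def Fm.replNom (b a : Nom) : Fm → Fm
  | .top => .top | .bot => .bot | .prp p => .prp p
  | .nom c => if c = b then .nom a else .nom c
  | .neg φ => .neg (φ.replNom b a)
  | .land φ ψ => .land (φ.replNom b a) (ψ.replNom b a)
  | .lor φ ψ => .lor (φ.replNom b a) (ψ.replNom b a)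
  | .imp φ ψ => .imp (φ.replNom b a) (ψ.replNom b a)
  | .dia α φ => .dia (α.replNom b a) (φ.replNom b a)
  | .box α φ => .box (α.replNom b a) (φ.replNom b a)
/-- Replace every occurrence of the nominal `b` by `a` in a program. -/
def Pg.replNom (b a : Nom) : Pg → Pg
  | .atom σ => .atom σ
  | .seq α β => .seq (α.replNom b a) (β.replNom b a)
  | .choice α β => .choice (α.replNom b a) (β.replNom b a)
  | .star α => .star (α.replNom b a)
  | .test φ => .test (φ.replNom b a)
end

/-- Replace `b` by `a` in a letter. -/
def Lab.replNom (b a : Nom) : Lab → Lab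
  | .atom σ => .atom σ
  | .test φ => .test (φ.replNom b a)

/-- Replace `b` by `a` inside an automaton (i.e. in the tests of its alphabet). -/
def Aut.replNom (b a : Nom) (A : Aut) : Aut :=
  { states := A.states, init := A.init, accept := A.accept,
    trans := fun q ω q' => ∃ ω₀, A.trans q ω₀ q' ∧ ω = ω₀.replNom b a }

/-- Replace `b` by `a` in an extended formula (including inside automata of
modal operators). -/
def EFm.replNom (b a : Nom) : EFm → EFm
  | .top => .top | .bot => .bot | .prp p => .prp p
  | .nom c => if c = b then .nom a else .nom c
  | .neg φ => .neg (φ.replNom b a)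
  | .land φ ψ => .land (φ.replNom b a) (ψ.replNom b a)
  | .lor φ ψ => .lor (φ.replNom b a) (ψ.replNom b a)
  | .imp φ ψ => .imp (φ.replNom b a) (ψ.replNom b a)
  | .dia α φ => .dia (α.replNom b a) (φ.replNom b a)
  | .box α φ => .box (α.replNom b a) (φ.replNom b a)
  | .diaA A q φ => .diaA (A.replNom b a) q (φ.replNom b a)
  | .boxA A q φ => .boxA (A.replNom b a) q (φ.replNom b a)

/-- Replace `b` by `a` in an item. -/
def Item.replNom (b a : Nom) : Item → Item
  | .fm φ => .fm (φ.replNom b a)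
  | .mem c φ => .mem (if c = b then a else c) (φ.replNom b a)
  | .rel σ c d => .rel σ (if c = b then a else c) (if d = b then a else d)

/-! ## The closures `cls_Z(Γ)` and `cls(Γ)` -/

/-- `cls_Z(Γ)`, parametrized by the chosen automata `aut α = Aut_α`. -/
inductive ClsZ (aut : Pg → Aut) (Γ : Finset Assertion) : Item → Prop where
  | ofGamma {ξ : Assertion} : ξ ∈ Γ → ClsZ aut Γ ξ.toItem
  | ofBsf {φ : Fm} : φ ∈ bsf Γ → ClsZ aut Γ (.fm φ.toE)
  | boxAut {α : Pg} {φ : Fm} {q : ℕ} :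
      (Fm.box α φ) ∈ bsf Γ → q ∈ (aut α).states →
      ClsZ aut Γ (.fm (.boxA (aut α) q φ.toE))
  | boxAutStep {α : Pg} {φ : Fm} {q : ℕ} {ω : Lab} :
      (Fm.box α φ) ∈ bsf Γ → q ∈ (aut α).states → ω ∈ α.alphabet →
      ClsZ aut Γ (.fm (.box ω.toPg (.boxA (aut α) q φ.toE)))
  | diaAut {α : Pg} {φ : Fm} {q : ℕ} :
      (Fm.dia α φ) ∈ bsf Γ → q ∈ (aut α).states →
      ClsZ aut Γ (.fm (.diaA (aut α) q φ.toE))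
  | diaAutStep {α : Pg} {φ : Fm} {q : ℕ} {ω : Lab} :
      (Fm.dia α φ) ∈ bsf Γ → q ∈ (aut α).states → ω ∈ α.alphabet →
      ClsZ aut Γ (.fm (.dia ω.toPg (.diaA (aut α) q φ.toE)))
  | nomi {φ : EFm} {a : Nom} :
      ClsZ aut Γ (.fm φ) → NomOccurs a Γ → ClsZ aut Γ (.mem a φ)

/-- `cls(Γ)` : the closure of `cls_Z(Γ)` under replacement of nominals
occurring in `Γ`. -/
inductive Cls (aut : Pg → Aut) (Γ : Finset Assertion) : Item → Prop where
  | base {ξ : Item} : ClsZ aut Γ ξ → Cls aut Γ ξ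
  | repl {ξ : Item} {a b : Nom} :
      Cls aut Γ ξ → NomOccurs a Γ → NomOccurs b Γ →
      Cls aut Γ (ξ.replNom b a)
/-! ## Tableaux of the calculus C_HPDL -/

inductive NType : Type where | state | nonState
deriving DecidableEq

inductive SType : Type where | complex | simple
deriving DecidableEq

/-- Statuses of tableau nodes. -/
inductive Status (V : Type) : Type where
  | unexpanded | expanded | incomplete | blocked | unsat
  | unsatWrt (U : Set V)

/-- The data structure of a tableau: a rooted graph whose nodes carry the
attributes Type, SType, Label, RFormulas, Status, AssSN and Repl, and whose
edges leaving states are labeled by sets of items. -/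
structure Tableau where
  V : Type
  vfin : Finite V
  E : V → V → Prop
  root : V
  ntype : V → NType
  stype : V → SType
  label : V → Set Item
  rformulas : V → Set Item
  status : V → Status V
  assSN : V → Set Item
  repl : V → Nom → Option Nom
  elabels : V → V → Set Item

/-- `FullLabel(v)`. -/
def Tableau.fullLabel (G : Tableau) (v : G.V) : Set Item :=
  G.label v ∪ G.rformulas v ∪
    {i | G.stype v = SType.complex ∧ ∃ a b, G.repl v b = some a ∧ i = Item.mem a (.nom b)}

/-- `v` is a complex state. -/
def Tableau.isComplexState (G : Tableau) (v : G.V) : Prop :=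
  G.stype v = SType.complex ∧ G.ntype v = NType.state

/-- `Status(v) ∉ {unsat} ∪ {unsat-wrt(U) : u ∈ U}`. -/
def Tableau.statusOkWrt (G : Tableau) (u v : G.V) : Prop :=
  G.status v ≠ Status.unsat ∧ ∀ U : Set G.V, G.status v = Status.unsatWrt U → u ∉ U

/-- `v` is a descendant of `u` (reflexive-transitive closure of the successor
relation). -/
def Tableau.Descendant (G : Tableau) (u v : G.V) : Prop :=
  Relation.ReflTransGen G.E u v

/-- `G` is a C_HPDL-tableau for the ABox `Γ`.  This predicate abstracts the
tableau calculus C_HPDL of Section 3 of the paper "Tableaux with Global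
Caching for Hybrid PDL": it records the structural invariants of the
construction (the root is a complex non-state labeled with `Γ`, global caching,
finiteness of labels, complex nodes carry assertions while simple nodes carry
formulas, only states have labeled outgoing edges); the graph is assumed to be
built by exhaustively applying the static rules, the nominal-replacement rule,
the rule (nom), the re-expansion rule, the state-forming rule, the transitional
rule and the status-update rule (unsat) of the calculus. -/
structure IsCHPDLTableau (Γ : Finset Assertion) (G : Tableau) : Prop where
  root_ntype : G.ntype G.root = NType.nonState
  root_stype : G.stype G.root = SType.complex
  root_label : G.label G.root = Assertion.toItem '' (↑Γ : Set Assertion)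
  globalCaching : ∀ v w : G.V, G.ntype v = G.ntype w → G.stype v = G.stype w →
      G.label v = G.label w → G.rformulas v = G.rformulas w →
      G.repl v = G.repl w → v = w
  label_finite : ∀ v, (G.label v).Finite
  rformulas_finite : ∀ v, (G.rformulas v).Finite
  complex_assertions : ∀ v, G.stype v = SType.complex → ∀ i ∈ G.label v, i.isAssertion
  simple_formulas : ∀ v, G.stype v = SType.simple → ∀ i ∈ G.label v, i.isFormula
  repl_only_complex : ∀ v, G.stype v = SType.simple → ∀ a, G.repl v a = none
  elabels_states : ∀ v w : G.V, (∃ i, i ∈ G.elabels v w) → G.ntype v = NType.state ∧ G.E v w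

/-! ## ◇-realizability and ◇-realizations (Definitions 3 and 6 of the paper) -/

/-- `o:φ` where `o` is a nominal or nothing. -/
def mkO (o : Option Nom) (φ : EFm) : Item :=
  match o with
  | none => .fm φ
  | some a => .mem a φ

/-- Extended formulas of the form `⟨A,q⟩φ` or `⟨ω⟩⟨A,q⟩φ`. -/
def EFm.isDiaShape : EFm → Prop
  | .diaA _ _ _ => True
  | .dia (.atom _) (.diaA _ _ _) => True
  | .dia (.test _) (.diaA _ _ _) => True
  | _ => False

/-- Items of the form `o:⟨A,q⟩φ` or `o:⟨ω⟩⟨A,q⟩φ`. -/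
def Item.isDiaShape : Item → Prop
  | .fm φ => φ.isDiaShape
  | .mem _ φ => φ.isDiaShape
  | .rel _ _ _ => False

/-- One step of a ◇-realization w.r.t. the complex state `u` (the propagation
conditions (b), (c), (f)–(k) of Definition 3 of the paper). -/
inductive RealStep (G : Tableau) (u : G.V) : G.V × Item → G.V × Item → Prop where
  /-- condition (b): follow a `δ_A`-transition inside the full label. -/
  | delta {v : G.V} {o : Option Nom} {A : Aut} {q : ℕ} {ω : Lab} {q' : ℕ} {φ : EFm} :
      A.trans q ω q' →
      mkO o (.dia ω.toPg (.diaA A q' φ)) ∈ G.fullLabel v →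
      RealStep G u (v, mkO o (.diaA A q φ)) (v, mkO o (.dia ω.toPg (.diaA A q' φ)))
  /-- condition (c): decompose a test. -/
  | testStep {v : G.V} {o : Option Nom} {ψ : Fm} {A : Aut} {q : ℕ} {φ : EFm} :
      mkO o ψ.toE ∈ G.fullLabel v →
      mkO o (.diaA A q φ) ∈ G.fullLabel v →
      RealStep G u (v, mkO o (.dia (.test ψ) (.diaA A q φ))) (v, mkO o (.diaA A q φ))
  /-- conditions (f)–(h): pass to a successor carrying (the trace of) the item. -/
  | succ {v w : G.V} {ξ : Item} :
      G.E v w → ξ ∈ G.fullLabel w →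
      RealStep G u (v, ξ) (w, ξ)
  /-- condition (j): follow a transitional edge of a state. -/
  | transEdge {v w : G.V} {o : Option Nom} {σ : APg} {A : Aut} {q : ℕ} {φ : EFm} :
      G.ntype v = NType.state → G.E v w →
      mkO o (.dia (.atom σ) (.diaA A q φ)) ∈ G.elabels v w →
      Item.fm (.diaA A q φ) ∈ G.label w →
      RealStep G u (v, mkO o (.dia (.atom σ) (.diaA A q φ))) (w, Item.fm (.diaA A q φ))
  /-- condition (k): jump via a nominal in the label back to `u`. -/
  | nomJump {v : G.V} {a : Nom} {φ : EFm} :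
      Item.fm (.nom a) ∈ G.label v →
      Item.mem a φ ∈ G.fullLabel u →
      RealStep G u (v, Item.fm φ) (u, Item.mem a φ)

/-- The final step of a ◇-realization w.r.t. `u` (the base conditions (a) and
(e) of Definition 3 of the paper), producing `ξ_{k+1} = o:φ`. -/
inductive RealLast (G : Tableau) (u : G.V) : G.V × Item → G.V × Item → Prop where
  /-- condition (a): `q` is accepting and `o:φ` already belongs to the full label. -/
  | inLabel {v : G.V} {o : Option Nom} {A : Aut} {q : ℕ} {φ : EFm} :
      q ∈ A.accept → mkO o φ ∈ G.fullLabel v →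
      RealLast G u (v, mkO o (.diaA A q φ)) (v, mkO o φ)
  /-- condition (e): `q` is accepting and the successor obtained by replacing
  the principal item by `o:φ` does not have status unsat/unsat-wrt-`u`. -/
  | viaSucc {v w : G.V} {o : Option Nom} {A : Aut} {q : ℕ} {φ : EFm} :
      q ∈ A.accept → G.E v w → mkO o φ ∈ G.label w → G.statusOkWrt u w →
      RealLast G u (v, mkO o (.diaA A q φ)) (w, mkO o φ)

/-- A ◇-realization of `ξ` at `v` w.r.t. `u` (Definition 6 of the paper):
a finite sequence `(v_0,ξ_0), …, (v_{k+1},ξ_{k+1})` starting at `(v,ξ)`, whose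
consecutive pairs are related by the propagation conditions, ending with a base
condition, such that every intermediate item is of the form `o:⟨A,q⟩φ` or
`o:⟨ω⟩⟨A,q⟩φ`, belongs to the corresponding full label, and the status of every
intermediate node is neither unsat nor unsat-wrt a set containing `u`. -/
def DmdRealization (G : Tableau) (u v : G.V) (ξ : Item) : Prop :=
  ∃ (k : ℕ) (f : ℕ → G.V × Item),
    f 0 = (v, ξ) ∧
    (∀ i < k, RealStep G u (f i) (f (i + 1))) ∧
    RealLast G u (f k) (f (k + 1)) ∧
    (∀ i ≤ k, (f i).2 ∈ G.fullLabel (f i).1 ∧ (f i).2.isDiaShape ∧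
      G.statusOkWrt u (f i).1)

/-! ## Model graphs (Definition 7 of the paper) -/

/-- The data of a model graph of a tableau `G`: nodes are nominals or
(simple state) nodes of `G`. -/
structure ModelGraph (G : Tableau) where
  V' : Set (Nom ⊕ G.V)
  E' : (Nom ⊕ G.V) → (Nom ⊕ G.V) → Prop
  label' : (Nom ⊕ G.V) → Set EFm
  elabels' : (Nom ⊕ G.V) → (Nom ⊕ G.V) → Set APg

/-- `g` is a model graph of `G` w.r.t. the complex state `u` (Definition 7 of
the paper).  This predicate records the initialization of the construction and
the closure property achieved by its while-loop: nominal nodes are those `a`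
with `Repl(u)(a) = a`, labeled by the formulas `φ` with `a:φ ∈ FullLabel(u)`
together with `a`; edges between nominal nodes come from the assertions
`σ(a,b) ∈ Label(u)`; the remaining nodes are simple states of `G` whose status
is neither unsat nor unsat-wrt-`u`; and every formula `⟨σ⟩⟨A,q⟩ψ` in a label is
realized by a `σ`-labeled edge (obtained in the construction by following a
◇-realization together with a saturation path w.r.t. `u`). -/
structure IsModelGraphOf (G : Tableau) (u : G.V) (g : ModelGraph G) : Prop where
  nom_mem : ∀ a : Nom, G.repl u a = some a → Sum.inl a ∈ g.V'
  nom_only : ∀ a : Nom, Sum.inl a ∈ g.V' → G.repl u a = some a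
  nom_label : ∀ a : Nom, G.repl u a = some a →
      g.label' (Sum.inl a) = {φ | Item.mem a φ ∈ G.fullLabel u} ∪ {EFm.nom a}
  init_edge : ∀ (σ : APg) (a b : Nom), Item.rel σ a b ∈ G.label u →
      g.E' (Sum.inl a) (Sum.inl b) ∧ σ ∈ g.elabels' (Sum.inl a) (Sum.inl b)
  nodes_simple_states : ∀ w : G.V, Sum.inr w ∈ g.V' →
      G.ntype w = NType.state ∧ G.stype w = SType.simple ∧ G.statusOkWrt u w
  node_labels : ∀ w : G.V, Sum.inr w ∈ g.V' →
      ∃ v : G.V, G.ntype v = NType.nonState ∧ G.E v w ∧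
        {φ | Item.fm φ ∈ G.fullLabel v} ⊆ g.label' (Sum.inr w)
  edges_in : ∀ x y, g.E' x y → x ∈ g.V' ∧ y ∈ g.V'
  realized : ∀ x ∈ g.V', ∀ (σ : APg) (A : Aut) (q : ℕ) (ψ : EFm),
      EFm.dia (.atom σ) (.diaA A q ψ) ∈ g.label' x →
      ∃ y ∈ g.V', g.E' x y ∧ σ ∈ g.elabels' x y ∧ EFm.diaA A q ψ ∈ g.label' y
noncomputable instance instDecEqLab : DecidableEq Lab := Classical.decEq _
noncomputable instance instDecEqEFm : DecidableEq EFm := Classical.decEq _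
noncomputable instance instDecEqItem : DecidableEq Item := Classical.decEq _

/-! ### Finset of subformulas -/
mutual
noncomputable def Fm.subF : Fm → Finset Fm
  | .top => {.top}
  | .bot => {.bot}
  | .prp p => {.prp p}
  | .nom a => {.nom a}
  | .neg φ => insert (.neg φ) φ.subF
  | .land φ ψ => insert (.land φ ψ) (φ.subF ∪ ψ.subF)
  | .lor φ ψ => insert (.lor φ ψ) (φ.subF ∪ ψ.subF)
  | .imp φ ψ => insert (.imp φ ψ) (φ.subF ∪ ψ.subF)
  | .dia α φ => insert (.dia α φ) (α.subF ∪ φ.subF)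
  | .box α φ => insert (.box α φ) (α.subF ∪ φ.subF)
noncomputable def Pg.subF : Pg → Finset Fm
  | .atom _ => ∅
  | .seq α β => α.subF ∪ β.subF
  | .choice α β => α.subF ∪ β.subF
  | .star α => α.subF
  | .test φ => φ.subF
end

theorem card_ins_union (x : Fm) (s t : Finset Fm) (a b : ℕ) (hs : s.card ≤ a) (ht : t.card ≤ b) :
    (insert x (s ∪ t)).card ≤ 1 + a + b := by
  have h1 := Finset.card_insert_le x (s ∪ t)
  have h2 := Finset.card_union_le s t
  omega

theorem card_un (s t : Finset Fm) (a b : ℕ) (hs : s.card ≤ a) (ht : t.card ≤ b) :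
    (s ∪ t).card ≤ 1 + a + b := by
  have h2 := Finset.card_union_le s t
  omega

mutual
theorem Fm.subF_card : ∀ φ : Fm, φ.subF.card ≤ φ.len
  | .top => by simp [Fm.subF, Fm.len]
  | .bot => by simp [Fm.subF, Fm.len]
  | .prp p => by simp [Fm.subF, Fm.len]
  | .nom a => by simp [Fm.subF, Fm.len]
  | .neg φ => by
      have h := Fm.subF_card φ
      have h1 := Finset.card_insert_le (Fm.neg φ) φ.subF
      simp only [Fm.subF, Fm.len]; omega
  | .land φ ψ => card_ins_union _ _ _ _ _ (Fm.subF_card φ) (Fm.subF_card ψ)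
  | .lor φ ψ => card_ins_union _ _ _ _ _ (Fm.subF_card φ) (Fm.subF_card ψ)
  | .imp φ ψ => card_ins_union _ _ _ _ _ (Fm.subF_card φ) (Fm.subF_card ψ)
  | .dia α φ => card_ins_union _ _ _ _ _ (Pg.subF_card α) (Fm.subF_card φ)
  | .box α φ => card_ins_union _ _ _ _ _ (Pg.subF_card α) (Fm.subF_card φ)
theorem Pg.subF_card : ∀ α : Pg, α.subF.card ≤ α.len
  | .atom _ => by simp [Pg.subF]
  | .seq α β => card_un _ _ _ _ (Pg.subF_card α) (Pg.subF_card β)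
  | .choice α β => card_un _ _ _ _ (Pg.subF_card α) (Pg.subF_card β)
  | .star α => by
      have h := Pg.subF_card α
      simp only [Pg.subF, Pg.len]; omega
  | .test φ => by
      have h := Fm.subF_card φ
      simp only [Pg.subF, Pg.len]; omega
end

theorem Fm.self_mem_subF (φ : Fm) : φ ∈ φ.subF := by
  cases φ <;> simp [Fm.subF]

mutual
theorem Fm.mem_subF (φ : Fm) : ∀ ψ : Fm, Subf φ ψ → φ ∈ ψ.subF
  | .top, h => by cases h; simp [Fm.subF]
  | .bot, h => by cases h; simp [Fm.subF]
  | .prp p, h => by cases h; simp [Fm.subF]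
  | .nom a, h => by cases h; simp [Fm.subF]
  | .neg ψ, h => by
      cases h with
      | refl => exact Fm.self_mem_subF _
      | neg h => simp [Fm.subF, Fm.mem_subF φ ψ h]
  | .land ψ χ, h => by
      cases h with
      | refl => exact Fm.self_mem_subF _
      | andl h => simp [Fm.subF, Fm.mem_subF φ ψ h]
      | andr h => simp [Fm.subF, Fm.mem_subF φ χ h]
  | .lor ψ χ, h => by
      cases h with
      | refl => exact Fm.self_mem_subF _
      | orl h => simp [Fm.subF, Fm.mem_subF φ ψ h]
      | orr h => simp [Fm.subF, Fm.mem_subF φ χ h]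
  | .imp ψ χ, h => by
      cases h with
      | refl => exact Fm.self_mem_subF _
      | impl h => simp [Fm.subF, Fm.mem_subF φ ψ h]
      | impr h => simp [Fm.subF, Fm.mem_subF φ χ h]
  | .dia α ψ, h => by
      cases h with
      | refl => exact Fm.self_mem_subF _
      | diaf h => simp [Fm.subF, Fm.mem_subF φ ψ h]
      | diap h => simp [Fm.subF, Pg.mem_subF φ α h]
  | .box α ψ, h => by
      cases h with
      | refl => exact Fm.self_mem_subF _
      | boxf h => simp [Fm.subF, Fm.mem_subF φ ψ h]
      | boxp h => simp [Fm.subF, Pg.mem_subF φ α h]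
theorem Pg.mem_subF (φ : Fm) : ∀ α : Pg, SubfP φ α → φ ∈ α.subF
  | .atom _, h => by cases h
  | .seq α β, h => by
      cases h with
      | seql h => simp [Pg.subF, Pg.mem_subF φ α h]
      | seqr h => simp [Pg.subF, Pg.mem_subF φ β h]
  | .choice α β, h => by
      cases h with
      | chl h => simp [Pg.subF, Pg.mem_subF φ α h]
      | chr h => simp [Pg.subF, Pg.mem_subF φ β h]
  | .star α, h => by
      cases h with
      | star h => simp [Pg.subF, Pg.mem_subF φ α h]
  | .test ψ, h => by
      cases h with
      | test h => simp [Pg.subF, Fm.mem_subF φ ψ h]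
end

mutual
theorem Fm.subF_len (φ : Fm) : ∀ ψ : Fm, φ ∈ ψ.subF → φ.len ≤ ψ.len
  | .top, h => by simp [Fm.subF] at h; simp [h]
  | .bot, h => by simp [Fm.subF] at h; simp [h]
  | .prp p, h => by simp [Fm.subF] at h; simp [h]
  | .nom a, h => by simp [Fm.subF] at h; simp [h]
  | .neg ψ, h => by
      simp only [Fm.subF, Finset.mem_insert] at h
      rcases h with rfl | h
      · exact le_rfl
      · have := Fm.subF_len φ ψ h
        simp only [Fm.len]; omega
  | .land ψ χ, h => by
      simp only [Fm.subF, Finset.mem_insert, Finset.mem_union] at h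
      rcases h with rfl | h | h
      · exact le_rfl
      · have := Fm.subF_len φ ψ h
        simp only [Fm.len]; omega
      · have := Fm.subF_len φ χ h
        simp only [Fm.len]; omega
  | .lor ψ χ, h => by
      simp only [Fm.subF, Finset.mem_insert, Finset.mem_union] at h
      rcases h with rfl | h | h
      · exact le_rfl
      · have := Fm.subF_len φ ψ h
        simp only [Fm.len]; omega
      · have := Fm.subF_len φ χ h
        simp only [Fm.len]; omega
  | .imp ψ χ, h => by
      simp only [Fm.subF, Finset.mem_insert, Finset.mem_union] at h
      rcases h with rfl | h | h
      · exact le_rfl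
      · have := Fm.subF_len φ ψ h
        simp only [Fm.len]; omega
      · have := Fm.subF_len φ χ h
        simp only [Fm.len]; omega
  | .dia α χ, h => by
      simp only [Fm.subF, Finset.mem_insert, Finset.mem_union] at h
      rcases h with rfl | h | h
      · exact le_rfl
      · have := Pg.subF_len φ α h
        simp only [Fm.len]; omega
      · have := Fm.subF_len φ χ h
        simp only [Fm.len]; omega
  | .box α χ, h => by
      simp only [Fm.subF, Finset.mem_insert, Finset.mem_union] at h
      rcases h with rfl | h | h
      · exact le_rfl
      · have := Pg.subF_len φ α h
        simp only [Fm.len]; omega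
      · have := Fm.subF_len φ χ h
        simp only [Fm.len]; omega
theorem Pg.subF_len (φ : Fm) : ∀ α : Pg, φ ∈ α.subF → φ.len ≤ α.len
  | .atom _, h => by simp [Pg.subF] at h
  | .seq α β, h => by
      simp only [Pg.subF, Finset.mem_union] at h
      rcases h with h | h
      · have := Pg.subF_len φ α h
        simp only [Pg.len]; omega
      · have := Pg.subF_len φ β h
        simp only [Pg.len]; omega
  | .choice α β, h => by
      simp only [Pg.subF, Finset.mem_union] at h
      rcases h with h | h
      · have := Pg.subF_len φ α h
        simp only [Pg.len]; omega
      · have := Pg.subF_len φ β h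
        simp only [Pg.len]; omega
  | .star α, h => by
      have := Pg.subF_len φ α h
      simp only [Pg.len]; omega
  | .test ψ, h => by
      have := Fm.subF_len φ ψ h
      simp only [Pg.len]; omega
end

theorem Fm.nnfNeg_len : ∀ φ : Fm, φ.nnfNeg.len ≤ 2 * φ.len
  | .top => by simp [Fm.nnfNeg, Fm.len]
  | .bot => by simp [Fm.nnfNeg, Fm.len]
  | .prp p => by simp [Fm.nnfNeg, Fm.len]
  | .nom a => by simp [Fm.nnfNeg, Fm.len]
  | .neg φ => by simp only [Fm.nnfNeg, Fm.len]; omega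
  | .land φ ψ => by
      have := Fm.nnfNeg_len φ; have := Fm.nnfNeg_len ψ
      simp only [Fm.nnfNeg, Fm.len]; omega
  | .lor φ ψ => by
      have := Fm.nnfNeg_len φ; have := Fm.nnfNeg_len ψ
      simp only [Fm.nnfNeg, Fm.len]; omega
  | .imp φ ψ => by
      have := Fm.nnfNeg_len ψ
      simp only [Fm.nnfNeg, Fm.len]; omega
  | .dia α φ => by
      have := Fm.nnfNeg_len φ
      simp only [Fm.nnfNeg, Fm.len]; omega
  | .box α φ => by
      have := Fm.nnfNeg_len φ
      simp only [Fm.nnfNeg, Fm.len]; omega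

/-! ### Alphabet as a finset -/
noncomputable def Pg.alphaF : Pg → Finset Lab
  | .atom σ => {.atom σ}
  | .test φ => {.test φ}
  | .seq α β => α.alphaF ∪ β.alphaF
  | .choice α β => α.alphaF ∪ β.alphaF
  | .star α => α.alphaF

theorem Pg.alphaF_card : ∀ α : Pg, α.alphaF.card ≤ α.len
  | .atom σ => by simp [Pg.alphaF, Pg.len]
  | .test φ => by simp [Pg.alphaF, Pg.len]
  | .seq α β => by
      have := Pg.alphaF_card α; have := Pg.alphaF_card β
      have := Finset.card_union_le α.alphaF β.alphaF
      simp only [Pg.alphaF, Pg.len]; omega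
  | .choice α β => by
      have := Pg.alphaF_card α; have := Pg.alphaF_card β
      have := Finset.card_union_le α.alphaF β.alphaF
      simp only [Pg.alphaF, Pg.len]; omega
  | .star α => by
      have := Pg.alphaF_card α
      simp only [Pg.alphaF, Pg.len]; omega

theorem Pg.mem_alphaF (ω : Lab) : ∀ α : Pg, ω ∈ α.alphabet → ω ∈ α.alphaF
  | .atom σ, h => by simpa [Pg.alphaF, Pg.alphabet] using h
  | .test φ, h => by simpa [Pg.alphaF, Pg.alphabet] using h
  | .seq α β, h => by
      rcases h with h | h
      · simp [Pg.alphaF, Pg.mem_alphaF ω α h]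
      · simp [Pg.alphaF, Pg.mem_alphaF ω β h]
  | .choice α β, h => by
      rcases h with h | h
      · simp [Pg.alphaF, Pg.mem_alphaF ω α h]
      · simp [Pg.alphaF, Pg.mem_alphaF ω β h]
  | .star α, h => by
      have h' : ω ∈ α.alphabet := h
      simp [Pg.alphaF, Pg.mem_alphaF ω α h']

/-! ### Finite superset of `bsf` and of the nominals -/
noncomputable def Assertion.bsfF : Assertion → Finset Fm
  | .mem _ ψ => ψ.subF ∪ ψ.subF.image Fm.nnfNeg
  | .rel _ _ _ => ∅

noncomputable def bsfF (Γ : Finset Assertion) : Finset Fm := Γ.biUnion Assertion.bsfF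

theorem bsfF_card (Γ : Finset Assertion) : (bsfF Γ).card ≤ 2 * aboxSize Γ := by
  unfold bsfF aboxSize
  refine Finset.card_biUnion_le.trans ?_
  rw [Finset.mul_sum]
  refine Finset.sum_le_sum fun ξ _ => ?_
  cases ξ with
  | mem a ψ =>
    have h1 := Finset.card_union_le ψ.subF (ψ.subF.image Fm.nnfNeg)
    have h2 : (ψ.subF.image Fm.nnfNeg).card ≤ _ := Finset.card_image_le
    have h3 := ψ.subF_card
    simp only [Assertion.bsfF, Assertion.len]; omega
  | rel σ a b => simp [Assertion.bsfF]

theorem len_le_aboxSize {Γ : Finset Assertion} {ξ : Assertion} (h : ξ ∈ Γ) :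
    ξ.len ≤ aboxSize Γ :=
  Finset.single_le_sum (f := Assertion.len) (fun _ _ => Nat.zero_le _) h

theorem bsfF_len {Γ : Finset Assertion} {φ : Fm} (h : φ ∈ bsfF Γ) : φ.len ≤ 2 * aboxSize Γ := by
  simp only [bsfF, Finset.mem_biUnion] at h
  obtain ⟨ξ, hξ, h⟩ := h
  have hl := len_le_aboxSize hξ
  cases ξ with
  | rel σ a b => simp [Assertion.bsfF] at h
  | mem a ψ =>
    simp only [Assertion.bsfF, Finset.mem_union, Finset.mem_image] at h
    simp only [Assertion.len] at hl
    rcases h with h | ⟨χ, h, rfl⟩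
    · have := Fm.subF_len _ _ h
      omega
    · have := Fm.subF_len _ _ h
      have := χ.nnfNeg_len
      omega

theorem mem_bsfF {Γ : Finset Assertion} {φ : Fm} (h : φ ∈ bsf Γ) : φ ∈ bsfF Γ := by
  simp only [bsfF, Finset.mem_biUnion]
  rcases h with ⟨ξ, hξ, a, ψ, rfl, h⟩ | ⟨ξ, hξ, a, ψ, χ, rfl, h, rfl⟩
  · exact ⟨_, hξ, by simp [Assertion.bsfF, Fm.mem_subF _ _ h]⟩
  · refine ⟨_, hξ, ?_⟩
    simp only [Assertion.bsfF, Finset.mem_union, Finset.mem_image]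
    exact Or.inr ⟨χ, Fm.mem_subF _ _ h, rfl⟩

def Fm.nomOf : Fm → Nom
  | .nom a => a
  | _ => 0

noncomputable def Assertion.nomF : Assertion → Finset Nom
  | .mem b φ => insert b (φ.subF.image Fm.nomOf)
  | .rel _ b c => {b, c}

noncomputable def nomF (Γ : Finset Assertion) : Finset Nom := Γ.biUnion Assertion.nomF

theorem nomF_card (Γ : Finset Assertion) : (nomF Γ).card ≤ aboxSize Γ := by
  unfold nomF aboxSize
  refine Finset.card_biUnion_le.trans ?_
  refine Finset.sum_le_sum fun ξ _ => ?_
  cases ξ with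
  | mem a ψ =>
    have h1 := Finset.card_insert_le a (ψ.subF.image Fm.nomOf)
    have h2 : (ψ.subF.image Fm.nomOf).card ≤ _ := Finset.card_image_le
    have h3 := ψ.subF_card
    simp only [Assertion.nomF, Assertion.len]; omega
  | rel σ a b =>
    have : ({a, b} : Finset ℕ).card ≤ 2 := Finset.card_le_two
    simp only [Assertion.nomF, Assertion.len]; omega

theorem mem_nomF {Γ : Finset Assertion} {a : Nom} (h : NomOccurs a Γ) : a ∈ nomF Γ := by
  obtain ⟨ξ, hξ, h⟩ := h
  simp only [nomF, Finset.mem_biUnion]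
  refine ⟨ξ, hξ, ?_⟩
  cases ξ with
  | mem b φ =>
    simp only [Assertion.nomF, Finset.mem_insert, Finset.mem_image]
    rcases h with h | h
    · exact Or.inl h
    · exact Or.inr ⟨_, Fm.mem_subF _ _ h, rfl⟩
  | rel σ b c =>
    simp only [Assertion.nomF, Finset.mem_insert, Finset.mem_singleton]
    exact h

/-! ### Finite superset of `ClsZ` -/
noncomputable def extF (aut : Pg → Aut) : Fm → Finset EFm
  | .box α φ => (aut α).states.image (fun q => EFm.boxA (aut α) q φ.toE) ∪
      ((aut α).states ×ˢ α.alphaF).image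
        (fun p => EFm.box p.2.toPg (.boxA (aut α) p.1 φ.toE))
  | .dia α φ => (aut α).states.image (fun q => EFm.diaA (aut α) q φ.toE) ∪
      ((aut α).states ×ˢ α.alphaF).image
        (fun p => EFm.dia p.2.toPg (.diaA (aut α) p.1 φ.toE))
  | _ => ∅

theorem extF_card (aut : Pg → Aut) (c : ℕ)
    (hc : ∀ α : Pg, (aut α).states.card ≤ c * α.len + c) (m : ℕ) (φ : Fm) (hm : φ.len ≤ m) :
    (extF aut φ).card ≤ c * (m + 1) ^ 2 := by
  have key : ∀ α : Pg, α.len ≤ m →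
      (aut α).states.card + (aut α).states.card * α.alphaF.card ≤ c * (m + 1) ^ 2 := by
    intro α hα
    have h1 := hc α
    have h2 := α.alphaF_card
    calc (aut α).states.card + (aut α).states.card * α.alphaF.card
        = (aut α).states.card * (α.alphaF.card + 1) := by ring
      _ ≤ (c * m + c) * (m + 1) :=
          Nat.mul_le_mul (h1.trans (by gcongr)) (by omega)
      _ = c * (m + 1) ^ 2 := by ring
  cases φ with
  | box α φ =>
    refine le_trans ?_ (key α (by simp only [Fm.len] at hm; omega))
    refine (Finset.card_union_le _ _).trans (Nat.add_le_add Finset.card_image_le ?_)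
    exact Finset.card_image_le.trans (Finset.card_product _ _).le
  | dia α φ =>
    refine le_trans ?_ (key α (by simp only [Fm.len] at hm; omega))
    refine (Finset.card_union_le _ _).trans (Nat.add_le_add Finset.card_image_le ?_)
    exact Finset.card_image_le.trans (Finset.card_product _ _).le
  | _ => simp [extF]

noncomputable def clsFm (aut : Pg → Aut) (Γ : Finset Assertion) : Finset EFm :=
  (bsfF Γ).image Fm.toE ∪ (bsfF Γ).biUnion (extF aut)

theorem clsFm_card (aut : Pg → Aut) (c : ℕ)
    (hc : ∀ α : Pg, (aut α).states.card ≤ c * α.len + c) (Γ : Finset Assertion) :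
    (clsFm aut Γ).card ≤ 2 * aboxSize Γ +
      2 * aboxSize Γ * (c * (2 * aboxSize Γ + 1) ^ 2) := by
  refine (Finset.card_union_le _ _).trans (Nat.add_le_add ?_ ?_)
  · exact Finset.card_image_le.trans (bsfF_card Γ)
  · refine (Finset.card_biUnion_le_card_mul _ _ _
      (fun φ hφ => extF_card aut c hc _ φ (bsfF_len hφ))).trans ?_
    exact Nat.mul_le_mul_right _ (bsfF_card Γ)

noncomputable def clsZF (aut : Pg → Aut) (Γ : Finset Assertion) : Finset Item :=
  Γ.image Assertion.toItem ∪ ((clsFm aut Γ).image Item.fm ∪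
    (nomF Γ ×ˢ clsFm aut Γ).image (fun p => Item.mem p.1 p.2))

theorem clsZF_card (aut : Pg → Aut) (c : ℕ)
    (hc : ∀ α : Pg, (aut α).states.card ≤ c * α.len + c) (Γ : Finset Assertion) :
    (clsZF aut Γ).card ≤ (5 + 36 * c) * aboxSize Γ ^ 4 := by
  have hF := clsFm_card aut c hc Γ
  have hN := nomF_card Γ
  have hG : Γ.card ≤ aboxSize Γ := by
    rw [Finset.card_eq_sum_ones]
    refine Finset.sum_le_sum fun ξ _ => ?_
    cases ξ <;> simp only [Assertion.len] <;> omega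
  have h1 : (clsZF aut Γ).card ≤ Γ.card + ((clsFm aut Γ).card +
      (nomF Γ).card * (clsFm aut Γ).card) := by
    refine (Finset.card_union_le _ _).trans (Nat.add_le_add Finset.card_image_le ?_)
    refine (Finset.card_union_le _ _).trans (Nat.add_le_add Finset.card_image_le ?_)
    exact Finset.card_image_le.trans (Finset.card_product _ _).le
  generalize aboxSize Γ = n at *
  rcases Nat.eq_zero_or_pos n with rfl | hn
  · have hF0 : (clsFm aut Γ).card = 0 := by simpa using hF
    have hG0 : Γ.card = 0 := Nat.le_zero.1 hG
    rw [hF0, hG0] at h1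
    simpa using h1
  have hF2 : (clsFm aut Γ).card ≤ (2 + 18 * c) * n ^ 3 := by
    calc _ ≤ _ := hF
      _ ≤ 2 * n ^ 3 + 2 * n * (c * (3 * n) ^ 2) := by
        gcongr
        · exact Nat.le_self_pow (by norm_num) n
        · omega
      _ = _ := by ring
  calc _ ≤ _ := h1
    _ = Γ.card + ((nomF Γ).card + 1) * (clsFm aut Γ).card := by ring
    _ ≤ n ^ 4 + (2 * n) * ((2 + 18 * c) * n ^ 3) := by
        gcongr
        · exact hG.trans (Nat.le_self_pow (by norm_num) n)
        · omega
    _ = (5 + 36 * c) * n ^ 4 := by ring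

theorem mem_clsZF {aut : Pg → Aut} {Γ : Finset Assertion} {ξ : Item} (h : ClsZ aut Γ ξ) :
    ξ ∈ clsZF aut Γ := by
  have step : ∀ φ, φ ∈ clsFm aut Γ → Item.fm φ ∈ clsZF aut Γ := by
    intro φ hφ
    simp only [clsZF, Finset.mem_union, Finset.mem_image]
    exact Or.inr (Or.inl ⟨φ, hφ, rfl⟩)
  have ext : ∀ χ φ, χ ∈ bsf Γ → φ ∈ extF aut χ → Item.fm φ ∈ clsZF aut Γ := by
    intro χ φ hχ hφ
    refine step _ (Finset.mem_union_right _ (Finset.mem_biUnion.2 ⟨χ, mem_bsfF hχ, hφ⟩))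
  induction h with
  | ofGamma h => exact Finset.mem_union_left _ (Finset.mem_image_of_mem _ h)
  | ofBsf h => exact step _ (Finset.mem_union_left _ (Finset.mem_image_of_mem _ (mem_bsfF h)))
  | boxAut h hq =>
    exact ext _ _ h (Finset.mem_union_left _ (Finset.mem_image.2 ⟨_, hq, rfl⟩))
  | @boxAutStep α φ q ω h hq hω =>
    exact ext _ _ h (Finset.mem_union_right _ (Finset.mem_image.2
      ⟨(q, ω), Finset.mem_product.2 ⟨hq, Pg.mem_alphaF _ _ hω⟩, rfl⟩))
  | diaAut h hq =>
    exact ext _ _ h (Finset.mem_union_left _ (Finset.mem_image.2 ⟨_, hq, rfl⟩))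
  | @diaAutStep α φ q ω h hq hω =>
    exact ext _ _ h (Finset.mem_union_right _ (Finset.mem_image.2
      ⟨(q, ω), Finset.mem_product.2 ⟨hq, Pg.mem_alphaF _ _ hω⟩, rfl⟩))
  | @nomi φ a h ha ih =>
    have hφ : φ ∈ clsFm aut Γ := by
      simp only [clsZF, Finset.mem_union, Finset.mem_image] at ih
      rcases ih with ⟨x, _, hx⟩ | ⟨x, hx, he⟩ | ⟨x, _, hx⟩
      · cases x <;> simp [Assertion.toItem] at hx
      · cases he; exact hx
      · simp at hx
    exact Finset.mem_union_right _ (Finset.mem_union_right _ (Finset.mem_image.2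
      ⟨(a, φ), Finset.mem_product.2 ⟨mem_nomF ha, hφ⟩, rfl⟩))

/-! ### Renaming of nominals along a function -/
mutual
def Fm.mapNom (f : Nom → Nom) : Fm → Fm
  | .top => .top | .bot => .bot | .prp p => .prp p
  | .nom c => .nom (f c)
  | .neg φ => .neg (φ.mapNom f)
  | .land φ ψ => .land (φ.mapNom f) (ψ.mapNom f)
  | .lor φ ψ => .lor (φ.mapNom f) (ψ.mapNom f)
  | .imp φ ψ => .imp (φ.mapNom f) (ψ.mapNom f)
  | .dia α φ => .dia (α.mapNom f) (φ.mapNom f)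
  | .box α φ => .box (α.mapNom f) (φ.mapNom f)
def Pg.mapNom (f : Nom → Nom) : Pg → Pg
  | .atom σ => .atom σ
  | .seq α β => .seq (α.mapNom f) (β.mapNom f)
  | .choice α β => .choice (α.mapNom f) (β.mapNom f)
  | .star α => .star (α.mapNom f)
  | .test φ => .test (φ.mapNom f)
end

def Lab.mapNom (f : Nom → Nom) : Lab → Lab
  | .atom σ => .atom σ
  | .test φ => .test (φ.mapNom f)

def Aut.mapNom (f : Nom → Nom) (A : Aut) : Aut :=
  { states := A.states, init := A.init, accept := A.accept,
    trans := fun q ω q' => ∃ ω₀, A.trans q ω₀ q' ∧ ω = ω₀.mapNom f }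

def EFm.mapNom (f : Nom → Nom) : EFm → EFm
  | .top => .top | .bot => .bot | .prp p => .prp p
  | .nom c => .nom (f c)
  | .neg φ => .neg (φ.mapNom f)
  | .land φ ψ => .land (φ.mapNom f) (ψ.mapNom f)
  | .lor φ ψ => .lor (φ.mapNom f) (ψ.mapNom f)
  | .imp φ ψ => .imp (φ.mapNom f) (ψ.mapNom f)
  | .dia α φ => .dia (α.mapNom f) (φ.mapNom f)
  | .box α φ => .box (α.mapNom f) (φ.mapNom f)
  | .diaA A q φ => .diaA (A.mapNom f) q (φ.mapNom f)
  | .boxA A q φ => .boxA (A.mapNom f) q (φ.mapNom f)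

def Item.mapNom (f : Nom → Nom) : Item → Item
  | .fm φ => .fm (φ.mapNom f)
  | .mem c φ => .mem (f c) (φ.mapNom f)
  | .rel σ c d => .rel σ (f c) (f d)

mutual
theorem Fm.mapNom_id : ∀ φ : Fm, φ.mapNom id = φ
  | .top => rfl | .bot => rfl | .prp _ => rfl | .nom _ => rfl
  | .neg φ => by simp [Fm.mapNom, Fm.mapNom_id φ]
  | .land φ ψ => by simp [Fm.mapNom, Fm.mapNom_id φ, Fm.mapNom_id ψ]
  | .lor φ ψ => by simp [Fm.mapNom, Fm.mapNom_id φ, Fm.mapNom_id ψ]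
  | .imp φ ψ => by simp [Fm.mapNom, Fm.mapNom_id φ, Fm.mapNom_id ψ]
  | .dia α φ => by simp [Fm.mapNom, Fm.mapNom_id φ, Pg.mapNom_id α]
  | .box α φ => by simp [Fm.mapNom, Fm.mapNom_id φ, Pg.mapNom_id α]
theorem Pg.mapNom_id : ∀ α : Pg, α.mapNom id = α
  | .atom _ => rfl
  | .seq α β => by simp [Pg.mapNom, Pg.mapNom_id α, Pg.mapNom_id β]
  | .choice α β => by simp [Pg.mapNom, Pg.mapNom_id α, Pg.mapNom_id β]
  | .star α => by simp [Pg.mapNom, Pg.mapNom_id α]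
  | .test φ => by simp [Pg.mapNom, Fm.mapNom_id φ]
end

theorem Lab.mapNom_id (ω : Lab) : ω.mapNom id = ω := by
  cases ω <;> simp [Lab.mapNom, Fm.mapNom_id]

theorem Aut.mapNom_id (A : Aut) : A.mapNom id = A := by
  cases A
  simp [Aut.mapNom, Lab.mapNom_id]

theorem EFm.mapNom_id (φ : EFm) : φ.mapNom id = φ := by
  induction φ <;> simp_all [EFm.mapNom, Pg.mapNom_id, Aut.mapNom_id]

theorem Item.mapNom_id (ξ : Item) : ξ.mapNom id = ξ := by
  cases ξ <;> simp [Item.mapNom, EFm.mapNom_id]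

/-- The function replacing `b` by `a`. -/
def rfun (b a : Nom) : Nom → Nom := fun c => if c = b then a else c

mutual
theorem Fm.replNom_mapNom (b a : Nom) (f : Nom → Nom) :
    ∀ φ : Fm, (φ.mapNom f).replNom b a = φ.mapNom (rfun b a ∘ f)
  | .top => rfl | .bot => rfl | .prp _ => rfl
  | .nom c => by
      simp only [Fm.mapNom, Fm.replNom, rfun, Function.comp]; split <;> rfl
  | .neg φ => by simp [Fm.mapNom, Fm.replNom, Fm.replNom_mapNom b a f φ]
  | .land φ ψ => by
      simp [Fm.mapNom, Fm.replNom, Fm.replNom_mapNom b a f φ, Fm.replNom_mapNom b a f ψ]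
  | .lor φ ψ => by
      simp [Fm.mapNom, Fm.replNom, Fm.replNom_mapNom b a f φ, Fm.replNom_mapNom b a f ψ]
  | .imp φ ψ => by
      simp [Fm.mapNom, Fm.replNom, Fm.replNom_mapNom b a f φ, Fm.replNom_mapNom b a f ψ]
  | .dia α φ => by
      simp [Fm.mapNom, Fm.replNom, Fm.replNom_mapNom b a f φ, Pg.replNom_mapNom b a f α]
  | .box α φ => by
      simp [Fm.mapNom, Fm.replNom, Fm.replNom_mapNom b a f φ, Pg.replNom_mapNom b a f α]
theorem Pg.replNom_mapNom (b a : Nom) (f : Nom → Nom) :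
    ∀ α : Pg, (α.mapNom f).replNom b a = α.mapNom (rfun b a ∘ f)
  | .atom _ => rfl
  | .seq α β => by
      simp [Pg.mapNom, Pg.replNom, Pg.replNom_mapNom b a f α, Pg.replNom_mapNom b a f β]
  | .choice α β => by
      simp [Pg.mapNom, Pg.replNom, Pg.replNom_mapNom b a f α, Pg.replNom_mapNom b a f β]
  | .star α => by simp [Pg.mapNom, Pg.replNom, Pg.replNom_mapNom b a f α]
  | .test φ => by simp [Pg.mapNom, Pg.replNom, Fm.replNom_mapNom b a f φ]
end

theorem Lab.replNom_mapNom (b a : Nom) (f : Nom → Nom) (ω : Lab) :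
    (ω.mapNom f).replNom b a = ω.mapNom (rfun b a ∘ f) := by
  cases ω <;> simp [Lab.mapNom, Lab.replNom, Fm.replNom_mapNom]

theorem Aut.replNom_mapNom (b a : Nom) (f : Nom → Nom) (A : Aut) :
    (A.mapNom f).replNom b a = A.mapNom (rfun b a ∘ f) := by
  simp only [Aut.mapNom, Aut.replNom, Aut.mk.injEq, true_and, and_true]
  funext q ω q'
  apply propext
  constructor
  · rintro ⟨_, ⟨ω₀, h, rfl⟩, rfl⟩
    exact ⟨ω₀, h, Lab.replNom_mapNom _ _ _ _⟩
  · rintro ⟨ω₀, h, rfl⟩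
    exact ⟨_, ⟨ω₀, h, rfl⟩, (Lab.replNom_mapNom _ _ _ _).symm⟩

theorem EFm.replNom_mapNom (b a : Nom) (f : Nom → Nom) (φ : EFm) :
    (φ.mapNom f).replNom b a = φ.mapNom (rfun b a ∘ f) := by
  induction φ with
  | nom c => simp only [EFm.mapNom, EFm.replNom, rfun, Function.comp]; split <;> rfl
  | _ => simp_all [EFm.mapNom, EFm.replNom, Pg.replNom_mapNom, Aut.replNom_mapNom]

theorem Item.replNom_mapNom (b a : Nom) (f : Nom → Nom) (ξ : Item) :
    (ξ.mapNom f).replNom b a = ξ.mapNom (rfun b a ∘ f) := by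
  cases ξ <;> simp [Item.mapNom, Item.replNom, EFm.replNom_mapNom, rfun]

/-- Extension of a self-map of a finite set by the identity. -/
def extFun (N : Finset Nom) (g : N → N) : Nom → Nom :=
  fun x => if h : x ∈ N then (g ⟨x, h⟩ : Nom) else x

theorem cls_repr {aut : Pg → Aut} {Γ : Finset Assertion} {ξ : Item} (h : Cls aut Γ ξ) :
    ∃ g : nomF Γ → nomF Γ, ∃ ξ₀, ClsZ aut Γ ξ₀ ∧ ξ = ξ₀.mapNom (extFun (nomF Γ) g) := by
  induction h with
  | @base ξ h =>
    refine ⟨id, ξ, h, ?_⟩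
    have : extFun (nomF Γ) id = id := by
      funext x; simp [extFun]
    rw [this, Item.mapNom_id]
  | @repl ξ a b h ha hb ih =>
    obtain ⟨g, ξ₀, h₀, rfl⟩ := ih
    refine ⟨fun x => if (g x : Nom) = b then ⟨a, mem_nomF ha⟩ else g x, ξ₀, h₀, ?_⟩
    rw [Item.replNom_mapNom]
    congr 1
    funext x
    by_cases hx : x ∈ nomF Γ
    · simp only [extFun, rfun, Function.comp, hx, dite_true]
      split <;> rfl
    · have hxb : x ≠ b := fun e => hx (e ▸ mem_nomF hb)
      simp [extFun, rfun, hx, hxb]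

/-! ## STATEMENT 2 (Lemma 1: sizes of the closures) -/

/-- Let `Γ` be an ABox in NNF of size `n`.  Then `|cls_Z(Γ)| = O(n⁴)` and there
is a polynomial `f` (here of the form `f(n) = c·(n+1)^c`) with
`|cls(Γ)| = O(2^{f(n)})`.  The closures are parametrized by the fixed automata
`Aut_α` (`aut α`), which recognize `L(α)` and whose numbers of states are
linear in the length of `α`. -/
theorem cls_cardinalities
    (aut : Pg → Aut)
    (haut : ∀ (α : Pg) (w : List Lab), AutLang (aut α) w ↔ w ∈ α.lang)
    (hlin : ∃ c : ℕ, ∀ α : Pg, (aut α).states.card ≤ c * α.len + c) :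
    (∃ C : ℕ, ∀ Γ : Finset Assertion, ABoxInNNF Γ →
        {ξ : Item | ClsZ aut Γ ξ}.ncard ≤ C * (aboxSize Γ) ^ 4 + C) ∧
    (∃ c : ℕ, ∀ Γ : Finset Assertion, ABoxInNNF Γ →
        {ξ : Item | Cls aut Γ ξ}.ncard ≤ 2 ^ (c * (aboxSize Γ + 1) ^ c)) := by
  obtain ⟨c, hc⟩ := hlin
  constructor
  · refine ⟨5 + 36 * c, fun Γ _ => ?_⟩
    have hsub : {ξ : Item | ClsZ aut Γ ξ} ⊆ ↑(clsZF aut Γ) := fun ξ h => mem_clsZF h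
    have h1 := Set.ncard_le_ncard hsub (Finset.finite_toSet _)
    rw [Set.ncard_coe_finset] at h1
    exact (h1.trans (clsZF_card aut c hc Γ)).trans (Nat.le_add_right _ _)
  · refine ⟨(5 + 36 * c) + 4, fun Γ _ => ?_⟩
    have hZ := clsZF_card aut c hc Γ
    have hN := nomF_card Γ
    have hsub : {ξ : Item | Cls aut Γ ξ} ⊆
        ↑(((Finset.univ : Finset (nomF Γ → nomF Γ)) ×ˢ clsZF aut Γ).image
          (fun p => p.2.mapNom (extFun (nomF Γ) p.1))) := by
      intro ξ h
      obtain ⟨g, ξ₀, h₀, rfl⟩ := cls_repr h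
      rw [Finset.mem_coe, Finset.mem_image]
      exact ⟨(g, ξ₀), Finset.mem_product.2 ⟨Finset.mem_univ _, mem_clsZF h₀⟩, rfl⟩
    have h1 := Set.ncard_le_ncard hsub (Finset.finite_toSet _)
    rw [Set.ncard_coe_finset] at h1
    have h2 := h1.trans Finset.card_image_le
    rw [Finset.card_product, Finset.card_univ, Fintype.card_fun, Fintype.card_coe] at h2
    generalize 5 + 36 * c = C at *
    generalize aboxSize Γ = n at *
    have hn : n + 1 ≤ 2 ^ n := Nat.lt_two_pow_self
    have hC : C ≤ 2 ^ C := Nat.lt_two_pow_self.le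
    calc _ ≤ _ := h2
      _ ≤ (n + 1) ^ n * (2 ^ C * (n + 1) ^ 4) := by
        refine Nat.mul_le_mul ?_ (hZ.trans (by gcongr; omega))
        exact (Nat.pow_le_pow_left (by omega) _).trans (Nat.pow_le_pow_right (by omega) hN)
      _ ≤ (2 ^ n) ^ n * (2 ^ C * (2 ^ n) ^ 4) := by gcongr
      _ = 2 ^ (n * n + C + n * 4) := by rw [← pow_mul, ← pow_mul, ← pow_add, ← pow_add, add_assoc]
      _ ≤ 2 ^ ((C + 4) * (n + 1) ^ (C + 4)) := by
        refine Nat.pow_le_pow_right (by norm_num) ?_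
        calc n * n + C + n * 4 ≤ (C + 4) * (n + 1) ^ 2 := by nlinarith [Nat.zero_le (C * n), Nat.zero_le (C * n ^ 2)]
          _ ≤ _ := by
            gcongr
            · omega
            · omega
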